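/- Let M be a matroid of rank r on a ground set of size n and let C be a circuit of M with |C| = r + 1 - d for some 0 ≤ d < r + 1. Then the winning probability satisfies β_C ≥ binom(n-d, |C|)^{-1}. -/

import Mathlib

open Finset

/-- A matroid presented by its collection of circuits (the valid sets of bingo
cards): nonempty ground set axioms (C1)-(C3) of the paper. -/
structure BingoMatroid (α : Type*) [DecidableEq α] where
  /-- the ground set -/
  E : Finset α
  /-- the circuits (bingo cards) -/
  circuits : Finset (Finset α)
  subset_ground : ∀ C ∈ circuits, C ⊆ E
  empty_not_mem : ∅ ∉ circuits
  antichain : ∀ C₁ ∈ circuits, ∀ C₂ ∈ circuits, C₁ ⊆ C₂ → C₁ = C₂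
  elimination : ∀ C₁ ∈ circuits, ∀ C₂ ∈ circuits, C₁ ≠ C₂ →
    ∀ e ∈ C₁ ∩ C₂, ∃ C₃ ∈ circuits, C₃ ⊆ (C₁ ∪ C₂) \ {e}

/-- The completion time `t_C(σ)`: the least `t` such that every element of `C`
has been called out among the first `t` values of `σ`. -/
noncomputable def hitTime {α : Type*} {n : ℕ} (σ : Fin n → α) (C : Finset α) : ℕ :=
  sInf {t : ℕ | ∀ x ∈ C, ∃ i : Fin n, (i : ℕ) < t ∧ σ i = x}

namespace BingoMatroid

variable {α : Type*} [DecidableEq α]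

/-- `C` wins the bingo game under calling order `σ`: it is completed strictly
before every other circuit. -/
def Wins (M : BingoMatroid α) (σ : Fin M.E.card ≃ {x // x ∈ M.E}) (C : Finset α) : Prop :=
  ∀ C' ∈ M.circuits, C' ≠ C →
    hitTime (fun i => (σ i : α)) C < hitTime (fun i => (σ i : α)) C'

/-- The winning probability `β_C`: the number of calling orders under which `C`
wins, divided by `n!`. -/
noncomputable def beta (M : BingoMatroid α) (C : Finset α) : ℚ :=
  (Nat.card {σ : Fin M.E.card ≃ {x // x ∈ M.E} // M.Wins σ C} : ℚ) /
    (Nat.factorial M.E.card : ℚ)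

/-- The timed winning probability `β_C(t)`: the probability that `C` wins and is
completed exactly in round `t`. -/
noncomputable def betaT (M : BingoMatroid α) (C : Finset α) (t : ℕ) : ℚ :=
  (Nat.card {σ : Fin M.E.card ≃ {x // x ∈ M.E} //
      M.Wins σ C ∧ hitTime (fun i => (σ i : α)) C = t} : ℚ) /
    (Nat.factorial M.E.card : ℚ)

/-- A set is independent if it is contained in the ground set and contains no circuit. -/
def Indep (M : BingoMatroid α) (I : Finset α) : Prop :=
  I ⊆ M.E ∧ ∀ C ∈ M.circuits, ¬ C ⊆ I

/-- The rank of the matroid: the maximum size of an independent set. -/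
noncomputable def rank (M : BingoMatroid α) : ℕ :=
  sSup {k : ℕ | ∃ I : Finset α, M.Indep I ∧ I.card = k}

/-- A basis is a maximal independent set. -/
def IsBase (M : BingoMatroid α) (B : Finset α) : Prop :=
  M.Indep B ∧ ∀ J : Finset α, M.Indep J → B ⊆ J → B = J

/-- A coloop is an element of the ground set contained in no circuit. -/
def IsColoop (M : BingoMatroid α) (e : α) : Prop :=
  e ∈ M.E ∧ ∀ C ∈ M.circuits, e ∉ C

/-- `D` is a circuit of the contraction `M/T`: a nonempty inclusion-minimal
member of `{C \ T : C a circuit of M}`. -/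
def IsContractCircuit (M : BingoMatroid α) (T D : Finset α) : Prop :=
  D.Nonempty ∧ (∃ C ∈ M.circuits, D = C \ T) ∧
    ∀ C' ∈ M.circuits, (C' \ T).Nonempty → ¬ (C' \ T) ⊂ D

end BingoMatroid

namespace BingoMatroid

variable {α : Type*} [DecidableEq α]

theorem bddAbove_card_indep (M : BingoMatroid α) :
    BddAbove {k : ℕ | ∃ I : Finset α, M.Indep I ∧ I.card = k} := by
  refine ⟨M.E.card, ?_⟩
  rintro k ⟨I, hI, rfl⟩
  exact card_le_card hI.1

theorem Indep.card_le_rank {M : BingoMatroid α} {I : Finset α} (hI : M.Indep I) :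
    I.card ≤ M.rank :=
  le_csSup M.bddAbove_card_indep ⟨I, hI, rfl⟩

theorem exists_indep_card_eq_rank (M : BingoMatroid α) :
    ∃ J : Finset α, M.Indep J ∧ J.card = M.rank := by
  have hempty : M.Indep ∅ := ⟨empty_subset _, fun C hC h =>
    M.empty_not_mem (subset_empty.1 h ▸ hC)⟩
  exact Nat.sSup_mem (s := {k : ℕ | ∃ I : Finset α, M.Indep I ∧ I.card = k})
    ⟨0, ∅, hempty, card_empty⟩ M.bddAbove_card_indep

/-- Adding one element to an independent set creates at most one circuit. -/
theorem Indep.circuit_unique {M : BingoMatroid α} {J : Finset α} (hJ : M.Indep J) {e : α}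
    {C₁ C₂ : Finset α} (h₁ : C₁ ∈ M.circuits) (h₂ : C₂ ∈ M.circuits)
    (hs₁ : C₁ ⊆ insert e J) (hs₂ : C₂ ⊆ insert e J) : C₁ = C₂ := by
  by_contra hne
  have key : ∀ D ∈ M.circuits, D ⊆ insert e J → e ∈ D := by
    intro D hD hs
    by_contra he
    exact hJ.2 D hD ((subset_insert_iff_of_notMem he).1 hs)
  obtain ⟨C₃, h₃, hs₃⟩ := M.elimination C₁ h₁ C₂ h₂ hne e
    (mem_inter.2 ⟨key _ h₁ hs₁, key _ h₂ hs₂⟩)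
  refine hJ.2 C₃ h₃ fun x hx => ?_
  have := hs₃ hx
  have := @hs₁ x
  have := @hs₂ x
  grind

/-- Every independent set extends to an independent set of cardinality the rank. -/
theorem Indep.exists_superset_card_eq_rank {M : BingoMatroid α} {I : Finset α}
    (hI : M.Indep I) : ∃ J, M.Indep J ∧ J.card = M.rank ∧ I ⊆ J := by
  suffices h : ∀ k, ∀ J, M.Indep J → J.card = M.rank → (I \ J).card = k →
      ∃ J, M.Indep J ∧ J.card = M.rank ∧ I ⊆ J by
    obtain ⟨J, hJ, hJr⟩ := M.exists_indep_card_eq_rank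
    exact h _ J hJ hJr rfl
  intro k
  induction k using Nat.strong_induction_on with
  | _ k ih =>
    intro J hJ hJr hk
    by_cases hIJ : I ⊆ J
    · exact ⟨J, hJ, hJr, hIJ⟩
    obtain ⟨e, heI, heJ⟩ := not_subset.1 hIJ
    have hdep : ∃ C ∈ M.circuits, C ⊆ insert e J := by
      by_contra! hno
      have hind : M.Indep (insert e J) := ⟨insert_subset (hI.1 heI) hJ.1, hno⟩
      have := hind.card_le_rank
      rw [card_insert_of_notMem heJ] at this
      omega
    obtain ⟨C, hC, hCs⟩ := hdep
    obtain ⟨f, hfC, hfI⟩ := not_subset.1 (hI.2 C hC)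
    have hfe : f ≠ e := fun h => hfI (h ▸ heI)
    have hfJ : f ∈ J := (mem_insert.1 (hCs hfC)).resolve_left hfe
    refine ih _ ?_ ((insert e J).erase f) ⟨?_, ?_⟩ ?_ rfl
    · rw [← hk]
      refine card_lt_card ⟨fun x hx => ?_, fun h => ?_⟩
      · grind
      · have := h (mem_sdiff.2 ⟨heI, heJ⟩)
        grind
    · exact (erase_subset _ _).trans (insert_subset (hI.1 heI) hJ.1)
    · intro C' hC' hs
      have := hJ.circuit_unique hC hC' hCs (hs.trans (erase_subset _ _))
      subst this
      exact notMem_erase f _ (hs hfC)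
    · rw [card_erase_of_mem (mem_insert_of_mem hfJ), card_insert_of_notMem heJ]
      omega

/-- A circuit `C` can be enlarged by `r + 1 - |C|` elements without creating a second circuit. -/
theorem exists_extension_unique_circuit (M : BingoMatroid α) {C : Finset α}
    (hC : C ∈ M.circuits) :
    ∃ D ⊆ M.E, Disjoint C D ∧ C.card + D.card = M.rank + 1 ∧
      ∀ C' ∈ M.circuits, C' ⊆ C ∪ D → C' = C := by
  obtain ⟨e, he⟩ : C.Nonempty :=
    nonempty_iff_ne_empty.2 fun h => M.empty_not_mem (h ▸ hC)
  have hI : M.Indep (C.erase e) := by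
    refine ⟨(erase_subset _ _).trans (M.subset_ground C hC), fun C' hC' hs => ?_⟩
    have := M.antichain C' hC' C hC (hs.trans (erase_subset _ _))
    subst this
    exact notMem_erase e _ (hs he)
  obtain ⟨J, hJ, hJr, hIJ⟩ := hI.exists_superset_card_eq_rank
  have heJ : e ∉ J := fun h => hJ.2 C hC fun x hx => by
    by_cases hxe : x = e
    · exact hxe ▸ h
    · exact hIJ (mem_erase.2 ⟨hxe, hx⟩)
  have hunion : C ∪ J \ C = insert e J := by
    ext x
    have := @hIJ x
    grind
  refine ⟨J \ C, sdiff_subset.trans hJ.1, disjoint_sdiff, ?_, fun C' hC' hs => ?_⟩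
  · rw [← card_union_of_disjoint disjoint_sdiff, hunion, card_insert_of_notMem heJ, hJr]
  · rw [hunion] at hs
    exact hJ.circuit_unique hC' hC hs (hunion ▸ subset_union_left)

end BingoMatroid

/-- Among the elements of `F`, one can select the `k` smallest ones for an injective ranking. -/
theorem exists_initial_subset {β γ : Type*} [DecidableEq β] [LinearOrder γ] (f : β → γ)
    (hf : Function.Injective f) (F : Finset β) (k : ℕ) (hk : k ≤ F.card) :
    ∃ T ⊆ F, T.card = k ∧ ∀ x ∈ T, ∀ y ∈ F \ T, f x < f y := by
  induction k with
  | zero => exact ⟨∅, empty_subset _, rfl, by simp⟩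
  | succ k ih =>
    obtain ⟨T, hTF, hTk, hT⟩ := ih (by omega)
    have hne : (F \ T).Nonempty := by
      rw [← card_pos, card_sdiff_of_subset hTF]
      omega
    obtain ⟨z, hz, hzmin⟩ := exists_min_image (F \ T) f hne
    have hz' := mem_sdiff.1 hz
    refine ⟨insert z T, insert_subset hz'.1 hTF, by rw [card_insert_of_notMem hz'.2, hTk], ?_⟩
    intro x hx y hy
    have hyT : y ∈ F \ T := by grind
    rcases mem_insert.1 hx with rfl | hx
    · refine lt_of_le_of_ne (hzmin y hyT) fun h => ?_
      have := hf h
      grind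
    · exact hT x hx y hyT

/-- Some permutation preserves `F` and carries one subset of `F` to another one of the same
size. -/
theorem exists_perm_preserving {β : Type*} [DecidableEq β] [Fintype β] {F T C : Finset β}
    (hT : T ⊆ F) (hC : C ⊆ F) (hcard : T.card = C.card) :
    ∃ π : Equiv.Perm β, (∀ x, π x ∈ C ↔ x ∈ T) ∧ ∀ x, π x ∈ F ↔ x ∈ F := by
  have e : {x : F // x.1 ∈ T} ≃ {x : F // x.1 ∈ C} :=
    ((Equiv.subtypeSubtypeEquivSubtype fun h => hT h).trans
      (Finset.equivOfCardEq hcard)).trans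
      (Equiv.subtypeSubtypeEquivSubtype fun h => hC h).symm
  have hmem : ∀ x (hx : x ∈ F), Equiv.Perm.ofSubtype e.extendSubtype x =
      (e.extendSubtype ⟨x, hx⟩ : F) := fun x hx => Equiv.Perm.ofSubtype_apply_of_mem _ hx
  have hnot : ∀ x, x ∉ F → Equiv.Perm.ofSubtype e.extendSubtype x = x :=
    fun x hx => Equiv.Perm.ofSubtype_apply_of_not_mem _ hx
  refine ⟨Equiv.Perm.ofSubtype e.extendSubtype, fun x => ?_, fun x => ?_⟩ <;>
    by_cases hx : x ∈ F
  · rw [hmem x hx]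
    by_cases hxT : x ∈ T
    · exact iff_of_true (e.extendSubtype_mem ⟨x, hx⟩ hxT) hxT
    · exact iff_of_false (e.extendSubtype_not_mem ⟨x, hx⟩ hxT) hxT
  · rw [hnot x hx]
    exact iff_of_false (fun h => hx (hC h)) fun h => hx (hT h)
  · rw [hmem x hx]
    exact iff_of_true (Subtype.prop _) hx
  · rw [hnot x hx]

/-- At least a `1 / (|F| choose |C|)` fraction of all orderings list the elements of `C` before
the other elements of `F`. -/
theorem factorial_le_card_precedes_mul_choose {β : Type*} [DecidableEq β] [Fintype β] {n : ℕ}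
    (hn : Fintype.card β = n) {F C : Finset β} (hC : C ⊆ F) :
    n.factorial ≤
      Nat.card {σ : Fin n ≃ β // ∀ x ∈ C, ∀ y ∈ F \ C, σ.symm x < σ.symm y} *
        F.card.choose C.card := by
  choose T hTF hTk hT using fun σ : Fin n ≃ β =>
    exists_initial_subset σ.symm σ.symm.injective F C.card (card_le_card hC)
  choose π hπC hπF using fun t : powersetCard C.card F =>
    exists_perm_preserving (mem_powersetCard.1 t.2).1 hC (mem_powersetCard.1 t.2).2
  let t : (Fin n ≃ β) → powersetCard C.card F :=
    fun σ => ⟨T σ, mem_powersetCard.2 ⟨hTF σ, hTk σ⟩⟩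
  let g : (Fin n ≃ β) →
      {σ : Fin n ≃ β // ∀ x ∈ C, ∀ y ∈ F \ C, σ.symm x < σ.symm y} × powersetCard C.card F :=
    fun σ => (⟨σ.trans (π (t σ)), fun x hx y hy => by
      have h₁ := hπC (t σ) ((π (t σ)).symm x)
      have h₂ := hπC (t σ) ((π (t σ)).symm y)
      have h₃ := hπF (t σ) ((π (t σ)).symm y)
      rw [Equiv.apply_symm_apply] at h₁ h₂ h₃
      rw [mem_sdiff] at hy
      exact hT σ _ (h₁.1 hx) _ (mem_sdiff.2 ⟨h₃.1 hy.1, fun h => hy.2 (h₂.2 h)⟩)⟩, t σ)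
  have hg : Function.Injective g := by
    intro σ τ h
    have h₂ : t σ = t τ := congrArg Prod.snd h
    have h₁ : σ.trans (π (t σ)) = τ.trans (π (t τ)) := congrArg (fun p => p.1.1) h
    rw [h₂] at h₁
    ext i
    exact (π (t τ)).injective (Equiv.congr_fun h₁ i)
  have hle := Nat.card_le_card_of_injective g hg
  rw [Nat.card_prod, Nat.card_eq_fintype_card (α := powersetCard C.card F), Fintype.card_coe,
    card_powersetCard, Nat.card_eq_fintype_card (α := Fin n ≃ β),
    Fintype.card_equiv (Fintype.equivFinOfCardEq hn).symm, Fintype.card_fin] at hle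
  exact hle

/-- If all of `C` is called before some element `y` of `C'`, then `C` is completed first. -/
theorem hitTime_lt_hitTime {α : Type*} {n : ℕ} {σ : Fin n → α} (hσ : Function.Injective σ)
    {C C' : Finset α} (hC' : ∀ x ∈ C', ∃ i, σ i = x) {j : Fin n} (hj : σ j ∈ C')
    (h : ∀ x ∈ C, ∃ i < j, σ i = x) : hitTime σ C < hitTime σ C' := by
  have h₁ : hitTime σ C ≤ j := Nat.sInf_le h
  have h₂ : hitTime σ C' ∈ {t : ℕ | ∀ x ∈ C', ∃ i : Fin n, (i : ℕ) < t ∧ σ i = x} := by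
    refine Nat.sInf_mem ⟨n, fun x hx => ?_⟩
    obtain ⟨i, hi⟩ := hC' x hx
    exact ⟨i, i.2, hi⟩
  obtain ⟨i, hi, hij⟩ := h₂ _ hj
  rw [hσ hij] at hi
  omega

/-- lower bound `β_C ≥ binom(n-d, |C|)⁻¹` where `|C| = r + 1 - d`. -/
theorem stmt7 {α : Type*} [DecidableEq α] (M : BingoMatroid α) (hE : M.E.Nonempty)
    (C : Finset α) (hC : C ∈ M.circuits)
    (r d : ℕ) (hr : M.rank = r) (hCcard : C.card = r + 1 - d) (hd : d < r + 1) :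
    (Nat.choose (M.E.card - d) C.card : ℚ)⁻¹ ≤ M.beta C := by
  obtain ⟨D, hDE, hCD, hcard, huniq⟩ := M.exists_extension_unique_circuit hC
  have hCE := M.subset_ground C hC
  have hDd : D.card = d := by omega
  have hsub : C ⊆ M.E \ D := subset_sdiff.2 ⟨hCE, hCD⟩
  have hFcard : (M.E \ D).card = M.E.card - d := by rw [card_sdiff_of_subset hDE, hDd]
  have hlift : ∀ S ⊆ M.E, (S.subtype (· ∈ M.E)).card = S.card := fun S hS => by
    rw [card_subtype, filter_true_of_mem fun x hx => hS hx]
  have hcount := factorial_le_card_precedes_mul_choose (Fintype.card_coe M.E)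
    (F := (M.E \ D).subtype (· ∈ M.E)) (C := C.subtype (· ∈ M.E)) (subtype_mono hsub)
  rw [hlift _ sdiff_subset, hlift _ hCE, hFcard] at hcount
  have hwins : ∀ σ : Fin M.E.card ≃ {x // x ∈ M.E},
      (∀ x ∈ C.subtype (· ∈ M.E), ∀ y ∈ (M.E \ D).subtype (· ∈ M.E) \ C.subtype (· ∈ M.E),
        σ.symm x < σ.symm y) → M.Wins σ C := by
    intro σ hσ C' hC' hne
    obtain ⟨y, hyC', hy⟩ := not_subset.1 fun h => hne (huniq C' hC' h)
    have hyE := M.subset_ground C' hC' hyC'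
    rw [mem_union, not_or] at hy
    refine hitTime_lt_hitTime (Subtype.val_injective.comp σ.injective)
      (fun x hx => ⟨σ.symm ⟨x, M.subset_ground C' hC' hx⟩, by simp⟩)
      (j := σ.symm ⟨y, hyE⟩) (by simpa using hyC')
      fun x hx => ⟨σ.symm ⟨x, hCE hx⟩, hσ _ (by simpa using hx) _ ?_, by simp⟩
    simp [hyE, hy.1, hy.2]
  have hle := Nat.card_le_card_of_injective _ (Subtype.impEmbedding _ _ hwins).injective
  have hpos : 0 < (M.E.card - d).choose C.card :=
    Nat.choose_pos (hFcard ▸ card_le_card hsub)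
  rw [BingoMatroid.beta, le_div_iff₀ (by exact_mod_cast Nat.factorial_pos _),
    inv_mul_le_iff₀ (by exact_mod_cast hpos), mul_comm]
  exact_mod_cast hcount.trans (Nat.mul_le_mul_right _ hle)
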